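/- arXiv:2604.12499 — 2 statements merged into one kernel-verified Lean document; each statement's English description precedes it below -/
import Mathlib

section
/- Let N(α₀,…,γ₁) denote the number of pairs (x₁, x₂) ∈ 𝔽_q × 𝔽_q with (x₁, x₂) ≠ (0, 0) satisfying both A(x₁, x₂) = 0 and B(x₁, x₂) = 0. Then: (i) if γ₀ ≠ 0 and γ₁ ≠ 0, then N ≤ 6; (ii) if α₀ = γ₀ = 0 and (α₁, γ₁) ≠ (0, 0), then N ≤ 6; (iii) if α₀ = α₁ = γ₀ = γ₁ = 0, then N ∈ {0, q−1}. -/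
open Polynomial in
theorem aux_roots {E : Type*} [Field E] [DecidableEq E] (b0 b1 b2 c0 c1 c2 : E)
    (h : b2 * c2 ≠ 0 ∨ (b0 * c0 ≠ 0)) :
    ∃ S : Finset E, S.card ≤ 6 ∧ ∀ x y : E, x ≠ 0 →
      b2 * x * y ^ 2 + (b1 * x + b0) * y + x ^ 2 = 0 →
      y ^ 2 + (c2 * x ^ 2 + c1 * x) * y + c0 * x = 0 → x ∈ S := by
  let P : E[X] := C ((b2 * c0 - 1) ^ 2) * X ^ 3 -
    (C (b2 * c2) * X ^ 3 + C (b2 * c1) * X ^ 2 - C b1 * X - C b0) *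
    (C (c0 * b1) * X + C (c0 * b0) - C c2 * X ^ 3 - C c1 * X ^ 2)
  have hdeg : P.natDegree ≤ 6 := by
    simp only [P]
    compute_degree
  have hP : P ≠ 0 := by
    intro h0
    rcases h with h | h
    · have h6 : P.coeff 6 = b2 * c2 * c2 := by
        simp only [P]
        compute_degree
        all_goals simp
      rw [h0] at h6
      have : c2 ≠ 0 := right_ne_zero_of_mul h
      exact mul_ne_zero h this (by simpa using h6.symm)
    · have h6 : P.eval 0 = b0 * (c0 * b0) := by
        simp [P]
      rw [h0] at h6
      have hb : b0 ≠ 0 := left_ne_zero_of_mul h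
      have hc : c0 ≠ 0 := right_ne_zero_of_mul h
      exact mul_ne_zero hb (mul_ne_zero hc hb) (by simpa using h6.symm)
  refine ⟨P.roots.toFinset, ?_, ?_⟩
  · exact (Multiset.toFinset_card_le _).trans ((card_roots' P).trans hdeg)
  · intro x y hx hf hg
    rw [Multiset.mem_toFinset, mem_roots hP, IsRoot.def]
    have key : x * P.eval x = 0 := by
      simp only [P, eval_sub, eval_mul, eval_add, eval_C, eval_X, eval_pow]
      have l1 : (b2*c2*x^3+b2*c1*x^2-b1*x-b0)*y + x^2*(b2*c0-1) = 0 := by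
        linear_combination b2*x*hg - hf
      have l2 : x^2*(b2*c0-1)*y + (c0*x*(b1*x+b0) - c2*x^4-c1*x^3) = 0 := by
        have hy : y ≠ 0 := by
          rintro rfl
          apply hx
          simpa using hf
        apply (mul_eq_zero.mp ?_).resolve_left hy
        linear_combination c0 * x * hf - x ^ 2 * hg
      linear_combination x^2*(b2*c0-1) * l1 - (b2*c2*x^3+b2*c1*x^2-b1*x-b0) * l2
    exact (mul_eq_zero.mp key).resolve_left hx

theorem aux_trace {F : Type*} [Field F] [Fintype F] [Algebra (ZMod 2) F] (δ e : F)
    (hδ : Algebra.trace (ZMod 2) F δ = 1) : e ^ 2 + e + δ ≠ 0 := by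
  intro h
  have : CharP F 2 := charP_of_injective_algebraMap (algebraMap (ZMod 2) F).injective 2
  have h1 : δ = e ^ 2 + e := by
    have h2 : (2 : F) = 0 := CharTwo.two_eq_zero
    linear_combination h - (e ^ 2 + e) * h2
  have h3 := Algebra.trace_eq_of_algEquiv (FiniteField.frobeniusAlgEquivOfAlgebraic (ZMod 2) F) e
  have h4 : (FiniteField.frobeniusAlgEquivOfAlgebraic (ZMod 2) F) e = e ^ 2 := by
    simp
  rw [h4] at h3
  rw [h1, map_add, h3, CharTwo.add_self_eq_zero] at hδ
  exact zero_ne_one hδ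

theorem aux_inj {F E : Type*} [Field F] [Field E] [Algebra F E] [CharP E 2] (δ : F) (e : E)
    (hno : ∀ t : F, t ^ 2 + t + δ ≠ 0) (he : e ^ 2 + e + algebraMap F E δ = 0) (a b : F)
    (h : algebraMap F E a + e * algebraMap F E b = 0) : a = 0 ∧ b = 0 := by
  by_cases hb : b = 0
  · subst hb
    simpa using h
  · exfalso
    apply hno (-(a / b))
    apply (algebraMap F E).injective
    have hb' : algebraMap F E b ≠ 0 := by simpa using hb
    have : e = algebraMap F E (-(a / b)) := by
      rw [map_neg, map_div₀]
      field_simp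
      linear_combination h
    rw [this] at he
    rw [map_zero, ← he]
    simp

theorem aux_eq {E : Type*} [Field E] [CharP E 2] (δ e x1 x2 a0 a1 b0 b1 g0 g1 : E)
    (he : e ^ 2 + e + δ = 0)
    (hx : x1 + e * x2 ≠ 0)
    (hA : (x1 ^ 2 + x1 * x2 + δ * x2 ^ 2) *
            (a0 + b0 * x1 + δ * b1 * x2 + g0 * (x1 ^ 2 + x1 * x2 + δ * x2 ^ 2)) +
          x1 ^ 3 + δ * x1 * x2 ^ 2 + δ * x2 ^ 3 = 0)
    (hB : (x1 ^ 2 + x1 * x2 + δ * x2 ^ 2) *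
            (a1 + b1 * x1 + (b0 + b1) * x2 + g1 * (x1 ^ 2 + x1 * x2 + δ * x2 ^ 2)) +
          x1 ^ 2 * x2 + x1 * x2 ^ 2 + (δ + 1) * x2 ^ 3 = 0) :
    (g0 + e * g1) * (x1 + e * x2) * (x1 + (e + 1) * x2) ^ 2 +
      ((b0 + e * b1) * (x1 + e * x2) + (a0 + e * a1)) * (x1 + (e + 1) * x2)
      + (x1 + e * x2) ^ 2 = 0 := by
  have h2 : (2 : E) = 0 := CharTwo.two_eq_zero
  have hn : x1 ^ 2 + x1 * x2 + δ * x2 ^ 2 = (x1 + e * x2) * (x1 + (e + 1) * x2) := by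
    linear_combination x2 ^ 2 * he - (e*x1*x2 + x2^2*(e^2+e)) * h2
  have hd : δ = e ^ 2 + e := by linear_combination he - (e^2+e) * h2
  rw [hn] at hA hB
  have hc : x1 ^ 3 + δ * x1 * x2 ^ 2 + δ * x2 ^ 3 + e * (x1 ^ 2 * x2 + x1 * x2 ^ 2 + (δ + 1) * x2 ^ 3)
      = (x1 + e * x2) ^ 3 := by
    subst hd
    linear_combination (-x1^2*x2*e -x1*x2^2*e^2 +e*x1*x2^2 + e*x2^3+e^2*x2^3) * h2
  have hl : (b0 * x1 + δ * b1 * x2) + e * (b1 * x1 + (b0 + b1) * x2)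
      = (b0 + e * b1) * (x1 + e * x2) := by
    subst hd
    linear_combination e * b1 * x2 * h2
  apply (mul_eq_zero.mp ?_).resolve_left hx
  linear_combination hA + e * hB - hc - (x1 + e * x2) * (x1 + (e + 1) * x2) * hl

theorem aux_root {E : Type*} [Field E] [IsAlgClosed E] (d : E) : ∃ e : E, e ^ 2 + e + d = 0 := by
  obtain ⟨e, he⟩ := IsAlgClosed.exists_root
    (Polynomial.X ^ 2 + Polynomial.X + Polynomial.C d : Polynomial E) (by
      have : (Polynomial.X ^ 2 + Polynomial.X + Polynomial.C d : Polynomial E).degree = 2 := by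
        compute_degree!
      rw [this]
      decide)
  exact ⟨e, by simpa [Polynomial.IsRoot.def] using he⟩

theorem aux_eq' {E : Type*} [Field E] [CharP E 2] (δ e x1 x2 b0 b1 : E)
    (he : e ^ 2 + e + δ = 0)
    (h : (b0 + e * b1) * (x1 + (e + 1) * x2) + (x1 + e * x2) = 0) :
    ((x1 ^ 2 + x1 * x2 + δ * x2 ^ 2) *
            (0 + b0 * x1 + δ * b1 * x2 + 0 * (x1 ^ 2 + x1 * x2 + δ * x2 ^ 2)) +
          x1 ^ 3 + δ * x1 * x2 ^ 2 + δ * x2 ^ 3) +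
    e * ((x1 ^ 2 + x1 * x2 + δ * x2 ^ 2) *
            (0 + b1 * x1 + (b0 + b1) * x2 + 0 * (x1 ^ 2 + x1 * x2 + δ * x2 ^ 2)) +
          x1 ^ 2 * x2 + x1 * x2 ^ 2 + (δ + 1) * x2 ^ 3) = 0 := by
  have h2 : (2 : E) = 0 := CharTwo.two_eq_zero
  have hn : x1 ^ 2 + x1 * x2 + δ * x2 ^ 2 = (x1 + e * x2) * (x1 + (e + 1) * x2) := by
    linear_combination x2 ^ 2 * he - (e*x1*x2 + x2^2*(e^2+e)) * h2
  have hd : δ = e ^ 2 + e := by linear_combination he - (e^2+e) * h2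
  have hc : x1 ^ 3 + δ * x1 * x2 ^ 2 + δ * x2 ^ 3 + e * (x1 ^ 2 * x2 + x1 * x2 ^ 2 + (δ + 1) * x2 ^ 3)
      = (x1 + e * x2) ^ 3 := by
    subst hd
    linear_combination (-x1^2*x2*e -x1*x2^2*e^2 +e*x1*x2^2 + e*x2^3+e^2*x2^3) * h2
  have hl : (b0 * x1 + δ * b1 * x2) + e * (b1 * x1 + (b0 + b1) * x2)
      = (b0 + e * b1) * (x1 + e * x2) := by
    subst hd
    linear_combination e * b1 * x2 * h2
  linear_combination hc + (x1 + e * x2) * (x1 + (e + 1) * x2) * hl + (x1 + e * x2) ^ 2 * h +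
    ((b0 * x1 + δ * b1 * x2) + e * (b1 * x1 + (b0 + b1) * x2)) * hn

theorem aux_bound {F : Type*} [Field F] [Fintype F] [DecidableEq F] [Algebra (ZMod 2) F] (δ : F)
    (hδ : Algebra.trace (ZMod 2) F δ = 1) (α₀ α₁ β₀ β₁ γ₀ γ₁ : F)
    (h : ¬ (γ₀ = 0 ∧ γ₁ = 0) ∨ ¬ (α₀ = 0 ∧ α₁ = 0)) :
    (Finset.univ.filter fun p : F × F => p ≠ (0, 0) ∧
        (p.1 ^ 2 + p.1 * p.2 + δ * p.2 ^ 2) *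
            (α₀ + β₀ * p.1 + δ * β₁ * p.2 + γ₀ * (p.1 ^ 2 + p.1 * p.2 + δ * p.2 ^ 2)) +
          p.1 ^ 3 + δ * p.1 * p.2 ^ 2 + δ * p.2 ^ 3 = 0 ∧
        (p.1 ^ 2 + p.1 * p.2 + δ * p.2 ^ 2) *
            (α₁ + β₁ * p.1 + (β₀ + β₁) * p.2 + γ₁ * (p.1 ^ 2 + p.1 * p.2 + δ * p.2 ^ 2)) +
          p.1 ^ 2 * p.2 + p.1 * p.2 ^ 2 + (δ + 1) * p.2 ^ 3 = 0).card ≤ 6 := by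
  classical
  have : CharP F 2 := charP_of_injective_algebraMap (algebraMap (ZMod 2) F).injective 2
  let E := AlgebraicClosure F
  let f : F →+* E := algebraMap F E
  have : CharP E 2 := charP_of_injective_algebraMap f.injective 2
  have h2 : (2 : E) = 0 := CharTwo.two_eq_zero
  obtain ⟨e, he⟩ : ∃ e : E, e ^ 2 + e + f δ = 0 := aux_root (f δ)
  have he' : (e + 1) ^ 2 + (e + 1) + f δ = 0 := by linear_combination he + (e + 1) * h2
  have hno : ∀ t : F, t ^ 2 + t + δ ≠ 0 := fun t => aux_trace δ t hδ
  have inj := aux_inj δ e hno he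
  have inj' := aux_inj δ (e + 1) hno he'
  obtain ⟨S, hS, hS'⟩ := aux_roots (f α₀ + e * f α₁) (f β₀ + e * f β₁) (f γ₀ + e * f γ₁)
    (f α₀ + (e + 1) * f α₁) (f β₀ + (e + 1) * f β₁) (f γ₀ + (e + 1) * f γ₁) (by
      rcases h with h | h
      · exact Or.inl (mul_ne_zero (fun h0 => h (inj _ _ h0)) (fun h0 => h (inj' _ _ h0)))
      · exact Or.inr (mul_ne_zero (fun h0 => h (inj _ _ h0)) (fun h0 => h (inj' _ _ h0))))
  refine le_trans (Finset.card_le_card_of_injOn (fun p => f p.1 + e * f p.2) ?_ ?_) hS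
  · rintro ⟨x1, x2⟩ hp
    simp only [Finset.coe_filter, Finset.mem_univ, true_and, Set.mem_ofPred_eq] at hp
    obtain ⟨hp, hA, hB⟩ := hp
    have hx : f x1 + e * f x2 ≠ 0 := fun h0 => hp (by simpa using inj _ _ h0)
    have hy : f x1 + (e + 1) * f x2 ≠ 0 := fun h0 => hp (by simpa using inj' _ _ h0)
    have hA' := congrArg f hA
    have hB' := congrArg f hB
    simp only [map_add, map_mul, map_pow, map_zero, map_one] at hA' hB'
    refine hS' _ (f x1 + (e + 1) * f x2) hx ?_ ?_
    · exact aux_eq (f δ) e _ _ _ _ _ _ _ _ he hx hA' hB'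
    · have := aux_eq (f δ) (e + 1) _ _ _ _ _ _ _ _ he' hy hA' hB'
      have h3 : e + 1 + 1 = e := by linear_combination h2
      rw [h3] at this
      linear_combination this
  · rintro ⟨x1, x2⟩ - ⟨y1, y2⟩ - hxy
    have := inj (x1 - y1) (x2 - y2) (by
      rw [map_sub, map_sub]
      simp only at hxy
      linear_combination hxy)
    simp only [sub_eq_zero] at this
    exact Prod.ext this.1 this.2

theorem aux_lin {F : Type*} [Field F] [Fintype F] [DecidableEq F] [Algebra (ZMod 2) F] (δ : F)
    (hδ : Algebra.trace (ZMod 2) F δ = 1) (β₀ β₁ : F) (s : Finset (F × F))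
    (hs : s = Finset.univ.filter fun p : F × F => p ≠ (0, 0) ∧
        (p.1 ^ 2 + p.1 * p.2 + δ * p.2 ^ 2) *
            (0 + β₀ * p.1 + δ * β₁ * p.2 + 0 * (p.1 ^ 2 + p.1 * p.2 + δ * p.2 ^ 2)) +
          p.1 ^ 3 + δ * p.1 * p.2 ^ 2 + δ * p.2 ^ 3 = 0 ∧
        (p.1 ^ 2 + p.1 * p.2 + δ * p.2 ^ 2) *
            (0 + β₁ * p.1 + (β₀ + β₁) * p.2 + 0 * (p.1 ^ 2 + p.1 * p.2 + δ * p.2 ^ 2)) +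
          p.1 ^ 2 * p.2 + p.1 * p.2 ^ 2 + (δ + 1) * p.2 ^ 3 = 0) :
    s.card = 0 ∨ s.card = Fintype.card F - 1 := by
  classical
  have : CharP F 2 := charP_of_injective_algebraMap (algebraMap (ZMod 2) F).injective 2
  let E := AlgebraicClosure F
  let f : F →+* E := algebraMap F E
  have : CharP E 2 := charP_of_injective_algebraMap f.injective 2
  have h2 : (2 : E) = 0 := CharTwo.two_eq_zero
  obtain ⟨e, he⟩ : ∃ e : E, e ^ 2 + e + f δ = 0 := aux_root (f δ)
  have hno : ∀ t : F, t ^ 2 + t + δ ≠ 0 := fun t => aux_trace δ t hδ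
  have inj := aux_inj δ e hno he
  -- the linear condition `b₁ * conj x + x = 0`
  let L : F × F →ₗ[F] E :=
    { toFun := fun p => (f β₀ + e * f β₁) * (f p.1 + (e + 1) * f p.2) + (f p.1 + e * f p.2)
      map_add' := by
        intro p r
        simp only [Prod.fst_add, Prod.snd_add, map_add]
        ring
      map_smul' := by
        intro t p
        simp only [Prod.smul_fst, Prod.smul_snd, smul_eq_mul, map_mul, RingHom.id_apply]
        rw [Algebra.smul_def]
        change _ = f t * _
        ring }
  have hL : ∀ p, L p = (f β₀ + e * f β₁) * (f p.1 + (e + 1) * f p.2) + (f p.1 + e * f p.2) :=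
    fun p => rfl
  have hmem : ∀ p : F × F, p ∈ s ↔ p ≠ 0 ∧ p ∈ LinearMap.ker L := by
    rintro ⟨x1, x2⟩
    rw [hs, LinearMap.mem_ker, hL]
    simp only [Finset.mem_filter, Finset.mem_univ, true_and]
    change _ ≠ 0 ∧ _ ↔ _
    refine and_congr_right fun hp => ?_
    have hx : f x1 + e * f x2 ≠ 0 := fun h0 => hp (by simpa using inj _ _ h0)
    constructor
    · rintro ⟨hA, hB⟩
      have hA' := congrArg f hA
      have hB' := congrArg f hB
      simp only [map_add, map_mul, map_pow, map_zero, map_one] at hA' hB'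
      have := aux_eq (f δ) e _ _ _ _ _ _ _ _ he hx hA' hB'
      apply (mul_eq_zero.mp ?_).resolve_left hx
      linear_combination this
    · intro h0
      apply inj
      simp only [map_add, map_mul, map_pow, map_zero, map_one]
      exact aux_eq' (f δ) e _ _ _ _ he h0
  have hcard : s.card + 1 = Fintype.card (LinearMap.ker L) := by
    have : insert 0 s = Finset.univ.filter (fun p => p ∈ LinearMap.ker L) := by
      ext p
      by_cases hp : p = 0
      · subst hp
        simp
      · simp [hmem, hp]
    rw [Fintype.card_subtype, ← this, Finset.card_insert_of_notMem]
    simp [hmem]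
  have hne : LinearMap.ker L ≠ ⊤ := by
    intro h0
    have h1 : L (1, 0) = 0 := by
      rw [← LinearMap.mem_ker, h0]
      trivial
    have h3 : L (0, 1) = 0 := by
      rw [← LinearMap.mem_ker, h0]
      trivial
    simp only [hL, map_zero, map_one] at h1 h3
    have : (1 : E) = 0 := by
      linear_combination (e + 1) * h1 - h3
    exact one_ne_zero this
  have hfin := Submodule.finrank_lt hne
  rw [Module.finrank_prod, Module.finrank_self] at hfin
  rw [Module.card_eq_pow_finrank (K := F)] at hcard
  have h01 : Module.finrank F (LinearMap.ker L) = 0 ∨ Module.finrank F (LinearMap.ker L) = 1 := by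
    omega
  rcases h01 with h | h <;> rw [h] at hcard
  · left
    simpa using hcard
  · right
    rw [pow_one] at hcard
    omega


/-- even characteristic: Let `q = 2^n ≥ 4` and `δ ∈ 𝔽_q` with
`Tr_{𝔽_q/𝔽₂}(δ) = 1`. Let `N(α₀,α₁,β₀,β₁,γ₀,γ₁)` be the number of pairs
`(x₁, x₂) ≠ (0,0)` in `𝔽_q × 𝔽_q` with `A(x₁,x₂) = 0` and `B(x₁,x₂) = 0`, where
`A = (X₁² + X₁X₂ + δX₂²)(α₀ + β₀X₁ + δβ₁X₂ + γ₀(X₁² + X₁X₂ + δX₂²)) + X₁³ + δX₁X₂² + δX₂³`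
and
`B = (X₁² + X₁X₂ + δX₂²)(α₁ + β₁X₁ + (β₀+β₁)X₂ + γ₁(X₁² + X₁X₂ + δX₂²)) + X₁²X₂ + X₁X₂² + (δ+1)X₂³`.
Then (i) if `γ₀ ≠ 0` and `γ₁ ≠ 0` then `N ≤ 6`; (ii) if `α₀ = γ₀ = 0` and
`(α₁, γ₁) ≠ (0, 0)` then `N ≤ 6`; (iii) if `α₀ = α₁ = γ₀ = γ₁ = 0` then `N ∈ {0, q−1}`. -/
theorem stmt_16 (q n : ℕ) (hn : 2 ≤ n) (hq : q = 2 ^ n)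
    (F : Type*) [Field F] [Fintype F] [DecidableEq F] (hF : Fintype.card F = q)
    [Algebra (ZMod 2) F] (δ : F) (hδ : Algebra.trace (ZMod 2) F δ = 1)
    (N : F → F → F → F → F → F → ℕ)
    (hN : ∀ α₀ α₁ β₀ β₁ γ₀ γ₁ : F, N α₀ α₁ β₀ β₁ γ₀ γ₁ =
      (Finset.univ.filter fun p : F × F => p ≠ (0, 0) ∧
        (p.1 ^ 2 + p.1 * p.2 + δ * p.2 ^ 2) *
            (α₀ + β₀ * p.1 + δ * β₁ * p.2 + γ₀ * (p.1 ^ 2 + p.1 * p.2 + δ * p.2 ^ 2)) +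
          p.1 ^ 3 + δ * p.1 * p.2 ^ 2 + δ * p.2 ^ 3 = 0 ∧
        (p.1 ^ 2 + p.1 * p.2 + δ * p.2 ^ 2) *
            (α₁ + β₁ * p.1 + (β₀ + β₁) * p.2 + γ₁ * (p.1 ^ 2 + p.1 * p.2 + δ * p.2 ^ 2)) +
          p.1 ^ 2 * p.2 + p.1 * p.2 ^ 2 + (δ + 1) * p.2 ^ 3 = 0).card) :
    (∀ α₀ α₁ β₀ β₁ γ₀ γ₁ : F, γ₀ ≠ 0 → γ₁ ≠ 0 → N α₀ α₁ β₀ β₁ γ₀ γ₁ ≤ 6) ∧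
    (∀ α₀ α₁ β₀ β₁ γ₀ γ₁ : F, α₀ = 0 → γ₀ = 0 → (α₁, γ₁) ≠ (0, 0) →
      N α₀ α₁ β₀ β₁ γ₀ γ₁ ≤ 6) ∧
    (∀ α₀ α₁ β₀ β₁ γ₀ γ₁ : F, α₀ = 0 → α₁ = 0 → γ₀ = 0 → γ₁ = 0 →
      N α₀ α₁ β₀ β₁ γ₀ γ₁ = 0 ∨ N α₀ α₁ β₀ β₁ γ₀ γ₁ = q - 1) := by
  refine ⟨?_, ?_, ?_⟩
  · intro α₀ α₁ β₀ β₁ γ₀ γ₁ h0 h1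
    rw [hN]
    exact aux_bound δ hδ _ _ _ _ _ _ (Or.inl fun h => h0 h.1)
  · intro α₀ α₁ β₀ β₁ γ₀ γ₁ h0 h1 h
    rw [hN]
    apply aux_bound δ hδ
    by_contra! hc
    exact h (by rw [hc.2.2, hc.1.2])
  · intro α₀ α₁ β₀ β₁ γ₀ γ₁ h0 h1 h2 h3
    subst h0 h1 h2 h3
    rw [hN, ← hF]
    exact aux_lin δ hδ β₀ β₁ _ rfl
end

section
/- Let q ≥ 4 and let τ ∈ 𝔽_{q²} satisfy τ^q + τ = 1. Then the maximum of N(b₀,b₁,b₂,ε) over all (b₀, b₁, b₂, ε) ∈ 𝔽_{q²}⁴ \ {(0,0,0,0)} is exactly q+1: every nonzero tuple satisfies N ≤ q+1, and there exists a nonzero tuple (for instance ε = 0, b₁ = 0, b₂ = 1, b₀ = τ·t with t ∈ 𝔽_q, t ≠ 0) with N = q+1. Consequently the minimum distance of the m = 3 code C_𝓛(𝙳,𝙶) equals q²−q−2, attaining the upper bound q²−1−(m−2)(q+1). -/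
namespace Stmt18

/-- A finset of roots of a nonzero quadratic has at most two elements. -/
lemma quad_card {F : Type*} [Field F] (A B C : F) (h : ¬ (A = 0 ∧ B = 0 ∧ C = 0))
    (S : Finset F) (hS : ∀ z ∈ S, A * z ^ 2 + B * z + C = 0) : S.card ≤ 2 := by
  by_contra hc
  obtain ⟨x, y, z, hx, hy, hz, hxy, hxz, hyz⟩ := Finset.two_lt_card_iff.1 (not_le.1 hc)
  have h1 := hS x hx
  have h2 := hS y hy
  have h3 := hS z hz
  have e1 : A * (x + y) + B = 0 := by
    apply mul_left_cancel₀ (sub_ne_zero.2 hxy)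
    linear_combination h1 - h2
  have e2 : A * (x + z) + B = 0 := by
    apply mul_left_cancel₀ (sub_ne_zero.2 hxz)
    linear_combination h1 - h3
  have hA : A = 0 := by
    apply mul_left_cancel₀ (sub_ne_zero.2 hyz)
    linear_combination e1 - e2
  have hB : B = 0 := by simpa [hA] using e1
  exact h ⟨hA, hB, by simpa [hA, hB] using h1⟩

/-- A finset of solutions of `z ^ n = k` has at most `n` elements. -/
lemma pow_card {F : Type*} [Field F] (n : ℕ) (hn : 0 < n) (k : F)
    (S : Finset F) (hS : ∀ z ∈ S, z ^ n = k) : S.card ≤ n := by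
  classical
  calc S.card ≤ (Polynomial.nthRoots n k).toFinset.card := by
        apply Finset.card_le_card
        intro z hz
        rw [Multiset.mem_toFinset, Polynomial.mem_nthRoots hn]
        exact hS z hz
    _ ≤ Multiset.card (Polynomial.nthRoots n k) := Multiset.toFinset_card_le _
    _ ≤ n := Polynomial.card_nthRoots n k

/-- Solutions of `z ^ q = k z`, `z ≠ 0`. -/
lemma pow_card' {F : Type*} [Field F] (q : ℕ) (hq : 2 ≤ q) (k : F)
    (S : Finset F) (hS : ∀ z ∈ S, z ≠ 0 ∧ z ^ q = k * z) : S.card ≤ q - 1 := by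
  apply pow_card (q - 1) (by omega) k
  intro z hz
  obtain ⟨h0, h1⟩ := hS z hz
  apply mul_right_cancel₀ h0
  rw [← h1, ← pow_succ]
  congr 1
  omega

/-- Conjugation. -/
lemma exists_conj (q : ℕ) (hq : IsPrimePow q) (F : Type*) [Field F] [Fintype F]
    (hF : Fintype.card F = q ^ 2) :
    ∃ σ : F →+* F, (∀ x, σ x = x ^ q) ∧ ∀ x, σ (σ x) = x := by
  obtain ⟨p, k, hp, hk, rfl⟩ := hq
  have hp' : p.Prime := hp.nat_prime
  have : Fact p.Prime := ⟨hp'⟩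
  have h0 : ((p : ℕ) : F) = 0 := by
    have := FiniteField.cast_card_eq_zero F
    rw [hF] at this
    push_cast at this
    exact eq_zero_of_pow_eq_zero (eq_zero_of_pow_eq_zero this)
  have : CharP F p := by
    obtain ⟨r, hr⟩ := CharP.exists F
    have : r ∣ p := (CharP.cast_eq_zero_iff F r p).1 h0
    rcases (Nat.dvd_prime hp').1 this with h | h
    · exact absurd h (CharP.char_ne_one F r)
    · rwa [h] at hr
  refine ⟨iterateFrobenius F p k, fun x => iterateFrobenius_def p k x, fun x => ?_⟩
  rw [iterateFrobenius_def, iterateFrobenius_def, ← pow_mul, ← sq, ← hF, FiniteField.pow_card]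

lemma two_fib {F α : Type*} [DecidableEq α] (S : Finset F) (f : F → α) (k : ℕ)
    (h : ∀ n ∈ S.image f, (S.filter fun x => f x = n).card ≤ k) :
    S.card ≤ k * (S.image f).card :=
  Finset.card_le_mul_card_image S k h

lemma b_zero {F : Type*} [Field F] [DecidableEq F] (q : ℕ) (hq4 : 4 ≤ q)
    (σ : F →+* F) (hσ : ∀ x, σ x = x ^ q) (hs : ∀ x, σ (σ x) = x)
    (a c : F) (S : Finset F)
    (hS : ∀ x ∈ S, x ≠ 0 ∧ x ^ 2 = σ x * (a + c * (x * σ x))) : S.card ≤ q + 1 := by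
  have hI : (S.image fun x => x * σ x).card ≤ 2 := by
    apply quad_card (c * σ c) (a * σ c + σ a * c - 1) (a * σ a)
    · rintro ⟨h1, h2, h3⟩
      have hc : c = 0 := by simpa using h1
      simp [hc] at h2
    · intro n hn
      obtain ⟨x, hx, rfl⟩ := Finset.mem_image.1 hn
      obtain ⟨h0, h1⟩ := hS x hx
      have h0' : σ x ≠ 0 := by simpa using h0
      have h3 := congrArg σ h1
      simp only [map_mul, map_add, map_pow, hs] at h3
      apply mul_left_cancel₀ (mul_ne_zero h0 h0')
      linear_combination (- σ x ^ 2) * h1 - (σ x * (a + c * (x * σ x))) * h3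
  by_cases hq : q = 4
  · have := two_fib S (fun x => x * σ x) 1 (by
      intro n hn
      rw [Finset.card_le_one]
      intro x hx y hy
      rw [Finset.mem_filter] at hx hy
      obtain ⟨hx, hxn⟩ := hx
      obtain ⟨hy, hyn⟩ := hy
      obtain ⟨x0, hx1⟩ := hS x hx
      obtain ⟨y0, hy1⟩ := hS y hy
      rw [hxn] at hx1
      rw [hyn] at hy1
      have e1 : x ^ 3 = y ^ 3 := by
        have : x ^ 3 = n * (a + c * n) := by rw [← hxn] at *; linear_combination x * hx1
        have : y ^ 3 = n * (a + c * n) := by rw [← hyn] at *; linear_combination y * hy1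
        simp_all
      have e2 : x ^ 5 = y ^ 5 := by
        rw [hσ, hq] at hxn hyn
        linear_combination hxn - hyn
      have : x ^ 6 * x = x ^ 6 * y := by
        have e3 : x ^ 6 = y ^ 6 := by linear_combination (x^3 + y^3) * e1
        have : x ^ 6 = x * y ^ 5 := by rw [← e2]; ring
        have h6 : y * y ^ 5 = x * y ^ 5 := by rw [← this, e3]; ring
        have : y = x := mul_right_cancel₀ (pow_ne_zero 5 y0) h6
        rw [this]
      exact mul_left_cancel₀ (pow_ne_zero 6 x0) this)
    omega
  · have := two_fib S (fun x => x * σ x) 3 (by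
      intro n hn
      apply pow_card 3 (by norm_num) (n * (a + c * n))
      intro x hx
      rw [Finset.mem_filter] at hx
      obtain ⟨hx, hxn⟩ := hx
      obtain ⟨x0, hx1⟩ := hS x hx
      rw [← hxn]
      linear_combination x * hx1)
    omega

lemma real_case {F : Type*} [Field F] [DecidableEq F] (q : ℕ) (hq4 : 4 ≤ q)
    (σ : F →+* F) (hσ : ∀ x, σ x = x ^ q) (hs : ∀ x, σ (σ x) = x)
    (h2 : q = 4 → (2 : F) = 0) (a b c : F) (ha : σ a = a) (hb : σ b = b)
    (hc : σ c = c) (hb0 : b ≠ 0) (S : Finset F)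
    (hS : ∀ x ∈ S, x ≠ 0 ∧ x ^ 2 = σ x * (a + b * x + c * (x * σ x))) : S.card ≤ q + 1 := by
  by_cases hd1 : c = 0 ∧ b - 1 = 0 ∧ a = 0
  · obtain ⟨rfl, hb1, rfl⟩ := hd1
    have := pow_card' q (by omega) 1 S (by
      intro x hx
      obtain ⟨x0, hx1⟩ := hS x hx
      refine ⟨x0, ?_⟩
      rw [← hσ]
      apply mul_left_cancel₀ x0
      linear_combination - hx1 - x * σ x * hb1)
    omega
  by_cases hd2 : c ^ 2 = 0 ∧ 2 * a * c - (1 + b) = 0 ∧ a ^ 2 = 0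
  · obtain ⟨h1, h3, h4⟩ := hd2
    have hc0 : c = 0 := eq_zero_of_pow_eq_zero h1
    have ha0 : a = 0 := eq_zero_of_pow_eq_zero h4
    subst hc0 ha0
    have := pow_card' q (by omega) (-1) S (by
      intro x hx
      obtain ⟨x0, hx1⟩ := hS x hx
      refine ⟨x0, ?_⟩
      rw [← hσ]
      apply mul_left_cancel₀ x0
      linear_combination  hx1 - x * σ x * h3)
    omega
  set R := S.filter fun x => σ x = x with hR
  set M := S.filter fun x => ¬ σ x = x with hM
  have hsum : R.card + M.card = S.card := Finset.card_filter_add_card_filter_not _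
  have hRe : ∀ x ∈ R, x ≠ 0 ∧ σ x = x ∧ c * x ^ 2 + (b - 1) * x + a = 0 := by
    intro x hx
    rw [hR, Finset.mem_filter] at hx
    obtain ⟨hx, hr⟩ := hx
    obtain ⟨x0, hx1⟩ := hS x hx
    refine ⟨x0, hr, ?_⟩
    rw [hr] at hx1
    apply mul_left_cancel₀ x0
    linear_combination - hx1
  have hMe : ∀ x ∈ M, x ≠ 0 ∧ x + σ x = - (a + c * (x * σ x)) ∧
      (x + σ x) ^ 2 = (1 + b) * (x * σ x) := by
    intro x hx
    rw [hM, Finset.mem_filter] at hx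
    obtain ⟨hx, hr⟩ := hx
    obtain ⟨x0, hx1⟩ := hS x hx
    have h3 := congrArg σ hx1
    simp only [map_mul, map_add, map_pow, hs, ha, hb, hc] at h3
    have ht : x + σ x = - (a + c * (x * σ x)) := by
      apply mul_left_cancel₀ (sub_ne_zero.2 hr)
      linear_combination h3 - hx1
    refine ⟨x0, ht, ?_⟩
    apply mul_left_cancel₀ x0
    linear_combination x * hx1 + (x * σ x) * ht
  set I := M.image fun x => x * σ x with hI
  have hIe : ∀ n ∈ I, n ≠ 0 ∧ σ n = n ∧ c ^ 2 * n ^ 2 + (2 * a * c - (1 + b)) * n + a ^ 2 = 0 := by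
    intro n hn
    obtain ⟨x, hx, rfl⟩ := Finset.mem_image.1 hn
    obtain ⟨x0, h3, h4⟩ := hMe x hx
    refine ⟨mul_ne_zero x0 (by simpa using x0), by simp [hs, mul_comm], ?_⟩
    rw [h3] at h4
    linear_combination h4
  have hMI : M.card ≤ 2 * I.card := by
    apply two_fib
    intro n hn
    apply quad_card 1 (a + c * n) n (by simp)
    intro x hx
    rw [Finset.mem_filter] at hx
    obtain ⟨hx, rfl⟩ := hx
    obtain ⟨x0, h3, h4⟩ := hMe x hx
    linear_combination x * h3
  have hR2 : R.card ≤ 2 := quad_card _ _ _ hd1 R fun x hx => (hRe x hx).2.2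
  have hI2 : I.card ≤ 2 := quad_card _ _ _ hd2 I fun x hx => (hIe x hx).2.2
  by_cases hq : q = 4
  · by_contra hcon
    have hR3 : R.card = 2 := by omega
    have hI3 : I.card = 2 := by omega
    have h20 := h2 hq
    have key : ∀ r s : F, r ≠ 0 → s ≠ 0 → r ≠ s → σ r = r → σ s = s →
        (r + s) * (r * s) = 1 := by
      intro r s r0 s0 hrs hr hs'
      rw [hσ, hq] at hr hs'
      have r3 : r ^ 3 = 1 := mul_left_cancel₀ r0 (by linear_combination hr)
      have s3 : s ^ 3 = 1 := mul_left_cancel₀ s0 (by linear_combination hs')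
      have e : r ^ 2 + r * s + s ^ 2 = 0 := by
        apply mul_left_cancel₀ (sub_ne_zero.2 hrs)
        linear_combination r3 - s3
      linear_combination s * e - s3 - h20
    obtain ⟨r, s, hrs, hRs⟩ := Finset.card_eq_two.1 hR3
    obtain ⟨m, n, hmn, hIs⟩ := Finset.card_eq_two.1 hI3
    obtain ⟨r0, rr, re⟩ := hRe r (by simp [hRs])
    obtain ⟨s0, sr, se⟩ := hRe s (by simp [hRs])
    obtain ⟨m0, mr, me⟩ := hIe m (by simp [hIs])
    obtain ⟨n0, nr, ne⟩ := hIe n (by simp [hIs])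
    have k1 := key r s r0 s0 hrs rr sr
    have k2 := key m n m0 n0 hmn mr nr
    have e1 : c * (r + s) = - (b - 1) := by
      apply mul_left_cancel₀ (sub_ne_zero.2 hrs)
      linear_combination re - se
    have e2 : c * (r * s) = a := by
      linear_combination r * e1 - re
    have e3 : c ^ 2 * (m + n) = - (2 * a * c - (1 + b)) := by
      apply mul_left_cancel₀ (sub_ne_zero.2 hmn)
      linear_combination me - ne
    have e4 : c ^ 2 * (m * n) = a ^ 2 := by
      linear_combination m * e3 - me
    have f1 : c ^ 2 = - (b - 1) * a := by
      rw [← e1, ← e2]; linear_combination - c ^ 2 * k1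
    have f2 : c ^ 4 = - (2 * a * c - (1 + b)) * a ^ 2 := by
      rw [← e3, ← e4]; linear_combination - c ^ 4 * k2
    have c0 : c ≠ 0 := by
      rintro rfl
      apply hd1
      exact ⟨rfl, by linear_combination e1, by linear_combination -e2⟩
    have f3 : a = c ^ 2 := by
      apply mul_left_cancel₀ (pow_ne_zero 2 c0)
      linear_combination a * f1 - f2 + (- a ^ 2 * b + a ^ 3 * c) * h20
    apply hb0
    have : (1 : F) = -(b - 1) := by
      apply mul_right_cancel₀ (pow_ne_zero 2 c0)
      rw [← f3]
      linear_combination f1 + f3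
    linear_combination this
  · omega

lemma main_bound {F : Type*} [Field F] [DecidableEq F] (q : ℕ) (hq4 : 4 ≤ q)
    (σ : F →+* F) (hσ : ∀ x, σ x = x ^ q) (hs : ∀ x, σ (σ x) = x)
    (h2 : q = 4 → (2 : F) = 0) (hz : ∃ z, σ z ≠ z) (a b c : F) (S : Finset F)
    (hS : ∀ x ∈ S, x ≠ 0 ∧ x ^ 2 = σ x * (a + b * x + c * (x * σ x))) : S.card ≤ q + 1 := by
  by_cases hb0 : b = 0
  · subst hb0
    exact b_zero q hq4 σ hσ hs a c S (by simpa using hS)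
  have hsb0 : σ b ≠ 0 := by simpa using hb0
  by_cases hs1 : ∃ s : F, σ s = s ∧ s ^ 2 = b * σ b ∧ s * b * σ a = (σ b) ^ 2 * a ∧
      s * b * σ c = (σ b) ^ 2 * c
  · obtain ⟨s, hss, hsb, hsa, hsc⟩ := hs1
    have s0 : s ≠ 0 := by
      rintro rfl
      have : b * σ b = 0 := by rw [← hsb]; simp
      exact mul_ne_zero hb0 hsb0 this
    obtain ⟨l, l0, hl⟩ : ∃ l : F, l ≠ 0 ∧ b * σ l = s * l := by
      by_cases hbs : s + b = 0
      · obtain ⟨z, hz⟩ := hz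
        refine ⟨z - σ z, sub_ne_zero.2 (Ne.symm hz), ?_⟩
        rw [map_sub, hs]
        linear_combination (σ z - z) * hbs
      · refine ⟨s + b, hbs, ?_⟩
        rw [map_add, hss]
        linear_combination - hsb
    have sl0 : σ l ≠ 0 := by simpa using l0
    have hb' : b = s * l / σ l := by field_simp; exact hl
    have hsb' : σ b = s * σ l / l := by
      rw [hb']; simp [hs, hss]
    have ra : σ a * l ^ 3 = a * (σ l) ^ 3 := by
      rw [hsb', hb'] at hsa
      field_simp at hsa
      linear_combination hsa
    have rc : σ c * l ^ 3 = c * (σ l) ^ 3 := by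
      rw [hsb', hb'] at hsc
      field_simp at hsc
      linear_combination hsc
    have := real_case q hq4 σ hσ hs h2 (a * σ l / l ^ 2) s (c * (σ l) ^ 2 / l)
      (by
        simp only [map_mul, map_div₀, map_pow, hs]
        field_simp
        linear_combination ra) hss
      (by
        simp only [map_mul, map_div₀, map_pow, hs]
        field_simp
        linear_combination rc) s0 (S.image fun x => x / l) (by
        intro y hy
        obtain ⟨x, hx, rfl⟩ := Finset.mem_image.1 hy
        obtain ⟨x0, hx1⟩ := hS x hx
        refine ⟨div_ne_zero x0 l0, ?_⟩
        rw [hb'] at hx1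
        simp only [map_div₀]
        field_simp
        field_simp at hx1
        linear_combination hx1)
    rwa [Finset.card_image_of_injective] at this
    intro x y hxy
    exact (div_left_inj' l0).1 hxy
  -- generic case
  set T := S.image fun x => x * σ x with hT
  have hTr : ∀ n ∈ T, n ≠ 0 ∧ σ n = n := by
    intro n hn
    obtain ⟨x, hx, rfl⟩ := Finset.mem_image.1 hn
    have x0 := (hS x hx).1
    exact ⟨mul_ne_zero x0 (by simpa using x0), by simp [hs, mul_comm]⟩
  have hTc : T.card ≤ q - 1 := by
    apply pow_card' q (by omega) 1
    intro n hn
    rw [← hσ]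
    simpa using hTr n hn
  have quads : ∀ n, σ n = n → ∀ x ∈ S, x * σ x = n →
      σ b * x ^ 2 + b * σ (a + c * n) * x + ((a + c * n) * σ (a + c * n) - n) = 0 ∧
      ((a + c * n) * σ (a + c * n) - n) * x ^ 2 + σ b * (a + c * n) * n * x + b * n ^ 2 = 0 := by
    intro n hn x hx hxn
    obtain ⟨x0, hx1⟩ := hS x hx
    have sx0 : σ x ≠ 0 := by simpa using x0
    have g1 : x ^ 2 = σ x * ((a + c * n) + b * x) := by rw [hx1, hxn]; ring
    have g2 := congrArg σ g1
    rw [map_mul, map_add (σ) (a + c * n) (b * x), map_mul σ b, map_pow, hs] at g2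
    generalize a + c * n = A at *
    have first : σ b * x ^ 2 + b * σ A * x + (A * σ A - n) = 0 := by
      apply mul_left_cancel₀ (mul_ne_zero x0 sx0)
      rw [← hxn]
      linear_combination (σ b * x * σ x - (σ x) ^ 2) * g1 - σ x * (A + b * x) * g2
    refine ⟨first, ?_⟩
    have sec := congrArg σ first
    simp only [map_mul, map_add, map_sub, map_pow, hs, map_zero, hn] at sec
    rw [← hxn] at sec ⊢
    linear_combination x ^ 2 * sec
  set f : F → ℕ := fun n => (S.filter fun x => x * σ x = n).card with hf
  set D := T.filter fun n => 1 < f n with hD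
  have hDe : ∀ n ∈ D, ∃ s : F, σ s = s ∧ s ^ 2 = b * σ b ∧
      s * b * σ (a + c * n) = (σ b) ^ 2 * (a + c * n) := by
    intro n hn
    rw [hD, Finset.mem_filter] at hn
    obtain ⟨hnT, hn1⟩ := hn
    obtain ⟨n0, hnr⟩ := hTr n hnT
    obtain ⟨x, y, hx, hy, hxy⟩ := Finset.one_lt_card_iff.1 hn1
    rw [Finset.mem_filter] at hx hy
    obtain ⟨p1, p2⟩ := quads n hnr x hx.1 hx.2
    obtain ⟨r1, r2⟩ := quads n hnr y hy.1 hy.2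
    have hmr : σ ((a + c * n) * σ (a + c * n) - n) = (a + c * n) * σ (a + c * n) - n := by
      simp only [map_mul, map_sub, hs, hnr]
      ring
    generalize a + c * n = A at *
    generalize A * σ A - n = m at *
    have K : m * b * σ A - (σ b) ^ 2 * A * n = 0 := by
      apply mul_left_cancel₀ (sub_ne_zero.2 hxy)
      linear_combination m * p1 - σ b * p2 - m * r1 + σ b * r2
    have L : m ^ 2 - b * σ b * n ^ 2 = 0 := by
      linear_combination m * p1 - σ b * p2 - x * K
    refine ⟨m / n, by rw [map_div₀, hmr, hnr], ?_, ?_⟩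
    · field_simp
      linear_combination L
    · field_simp
      linear_combination K
  have hDc : D.card ≤ 2 := by
    choose! g hg1 hg2 hg3 using hDe
    have : (D.image g).card ≤ 2 := by
      apply pow_card 2 (by norm_num) (b * σ b)
      intro z hz
      obtain ⟨n, hn, rfl⟩ := Finset.mem_image.1 hz
      exact hg2 n hn
    rwa [Finset.card_image_of_injOn] at this
    intro n hn n' hn' hnn
    by_contra hne
    apply hs1
    have hn := Finset.mem_coe.1 hn
    have hn' := Finset.mem_coe.1 hn'
    have hr := (hTr n (Finset.mem_filter.1 hn).1).2
    have hr' := (hTr n' (Finset.mem_filter.1 hn').1).2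
    have h3 := hg3 n hn
    have h4 := hg3 n' hn'
    rw [← hnn] at h4
    simp only [map_add, map_mul, hr, hr'] at h3 h4
    have h5 : g n * b * σ c = (σ b) ^ 2 * c := by
      apply mul_left_cancel₀ (sub_ne_zero.2 hne)
      linear_combination h3 - h4
    exact ⟨g n, hg1 n hn, hg2 n hn, by linear_combination h3 - n * h5, h5⟩
  have hcount : S.card = ∑ n ∈ T, f n :=
    Finset.card_eq_sum_card_fiberwise (fun x hx => Finset.mem_image_of_mem _ hx)
  have hle : ∑ n ∈ T, f n ≤ ∑ n ∈ T, (1 + if 1 < f n then 1 else 0) := by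
    apply Finset.sum_le_sum
    intro n hn
    have : f n ≤ 2 := by
      apply quad_card (σ b) _ _ (fun h => hsb0 h.1)
      intro x hx
      rw [Finset.mem_filter] at hx
      exact (quads n (hTr n hn).2 x hx.1 hx.2).1
    split_ifs <;> omega
  rw [Finset.sum_add_distrib, Finset.sum_const, ← Finset.card_filter, smul_eq_mul, mul_one] at hle
  change _ ≤ T.card + D.card at hle
  omega

lemma norm_fiber (q : ℕ) (hq4 : 4 ≤ q) {F : Type*} [Field F] [Fintype F] [DecidableEq F]
    (hF : Fintype.card F = q ^ 2) (k : F) (hk : k ≠ 0) (hkq : k ^ q = k) :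
    (Finset.univ.filter fun x : F => x ≠ 0 ∧ x ^ (q + 1) = k).card = q + 1 := by
  set U := Finset.univ.filter fun x : F => x ≠ 0 with hU
  set T := Finset.univ.filter fun x : F => x ≠ 0 ∧ x ^ q = x with hT
  have hUc : U.card = q ^ 2 - 1 := by
    rw [hU, Finset.filter_ne', Finset.card_erase_of_mem (Finset.mem_univ _), Finset.card_univ, hF]
  have hTc : T.card ≤ q - 1 := by
    apply pow_card' q (by omega) 1
    intro z hz
    simpa [hT] using hz
  have hsum : U.card = ∑ n ∈ T, (U.filter fun x => x ^ (q + 1) = n).card := by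
    apply Finset.card_eq_sum_card_fiberwise
    intro x hx
    have hx : x ≠ 0 := by simpa [hU] using hx
    simp only [hT, Finset.coe_filter, Finset.mem_univ, true_and, Set.mem_ofPred_eq]
    refine ⟨pow_ne_zero _ hx, ?_⟩
    rw [← pow_mul, show (q + 1) * q = q ^ 2 + q by ring, pow_add, ← hF, FiniteField.pow_card]
    ring
  have hle : ∀ n ∈ T, (U.filter fun x => x ^ (q + 1) = n).card ≤ q + 1 := by
    intro n _
    apply pow_card (q + 1) (by omega) n
    intro x hx
    exact (Finset.mem_filter.1 hx).2
  have hkT : k ∈ T := by simp [hT, hk, hkq]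
  have e : (Finset.univ.filter fun x : F => x ≠ 0 ∧ x ^ (q + 1) = k) =
      U.filter fun x => x ^ (q + 1) = k := by
    rw [hU, Finset.filter_filter]
  rw [e]
  by_contra hne
  have hlt : (U.filter fun x => x ^ (q + 1) = k).card < q + 1 := lt_of_le_of_ne (hle k hkT) hne
  have := Finset.sum_lt_sum hle ⟨k, hkT, hlt⟩
  rw [← hsum, Finset.sum_const, smul_eq_mul, hUc] at this
  have h3 : T.card * (q + 1) ≤ (q - 1) * (q + 1) := Nat.mul_le_mul_right _ hTc
  have h4 : (q - 1) * (q + 1) = q ^ 2 - 1 := by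
    obtain ⟨r, rfl⟩ : ∃ r, q = r + 1 := ⟨q - 1, by omega⟩
    simp only [Nat.add_sub_cancel]
    rw [show (r + 1) ^ 2 = r * (r + 1 + 1) + 1 by ring]
    simp
  omega

end Stmt18

theorem stmt_18 (q : ℕ) (hq : IsPrimePow q) (hq4 : 4 ≤ q)
    (F : Type*) [Field F] [Fintype F] [DecidableEq F] (hF : Fintype.card F = q ^ 2)
    (τ : F) (hτ : τ ^ q + τ = 1)
    (N : F → F → F → F → ℕ)
    (hN : ∀ b₀ b₁ b₂ ε : F, N b₀ b₁ b₂ ε =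
      (Finset.univ.filter fun x : F => x ≠ 0 ∧
        τ * x ^ (q + 1) * (b₀ + b₁ * x + b₂ * τ * x ^ (q + 1)) + ε * x ^ 3 = 0).card) :
    (∀ b₀ b₁ b₂ ε : F, (b₀, b₁, b₂, ε) ≠ (0, 0, 0, 0) → N b₀ b₁ b₂ ε ≤ q + 1) ∧
    (∀ t : F, t ^ q = t → t ≠ 0 → N (τ * t) 0 1 0 = q + 1) ∧
    (∃ b₀ b₁ b₂ ε : F, (b₀, b₁, b₂, ε) ≠ (0, 0, 0, 0) ∧ N b₀ b₁ b₂ ε = q + 1) := by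
  obtain ⟨σ, hσ, hs⟩ := Stmt18.exists_conj q hq F hF
  have τ0 : τ ≠ 0 := by
    rintro rfl
    rw [zero_pow (by omega)] at hτ
    simp at hτ
  have h2 : q = 4 → (2 : F) = 0 := by
    intro h
    have := FiniteField.cast_card_eq_zero F
    rw [hF, h] at this
    have h16 : (2 : F) ^ 4 = 0 := by
      rw [← this]; norm_num
    exact eq_zero_of_pow_eq_zero h16
  have hz : ∃ z, σ z ≠ z := by
    by_contra! h
    have h1 := Stmt18.pow_card' q (by omega) (1 : F) (Finset.univ.filter fun x : F => x ≠ 0) (by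
      intro z hz
      refine ⟨by simpa using hz, ?_⟩
      rw [← hσ, h, one_mul])
    rw [Finset.filter_ne', Finset.card_erase_of_mem (Finset.mem_univ _), Finset.card_univ, hF] at h1
    have : 4 * q ≤ q ^ 2 := by nlinarith
    omega
  have part2 : ∀ t : F, t ^ q = t → t ≠ 0 → N (τ * t) 0 1 0 = q + 1 := by
    intro t ht t0
    refine Eq.trans ?_ (Stmt18.norm_fiber q hq4 hF (-t) (neg_ne_zero.2 t0)
      (by rw [← hσ, map_neg, hσ, ht]))
    rw [hN]
    congr 1
    apply Finset.filter_congr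
    intro x _
    apply and_congr_right
    intro x0
    have hp := pow_ne_zero (q + 1) x0
    constructor
    · intro h
      apply mul_left_cancel₀ (mul_ne_zero (mul_ne_zero τ0 τ0) hp)
      linear_combination h
    · intro h
      rw [h]
      ring
  refine ⟨?_, part2, ⟨τ * 1, 0, 1, 0, by simp, part2 1 (one_pow q) one_ne_zero⟩⟩
  intro b₀ b₁ b₂ ε hne
  rw [hN]
  by_cases hε : ε = 0
  · subst hε
    have hred : ∀ x ∈ (Finset.univ.filter fun x : F => x ≠ 0 ∧
        τ * x ^ (q + 1) * (b₀ + b₁ * x + b₂ * τ * x ^ (q + 1)) + 0 * x ^ 3 = 0),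
        x ≠ 0 ∧ b₀ + b₁ * x + b₂ * τ * x ^ (q + 1) = 0 := by
      intro x hx
      obtain ⟨x0, hx1⟩ := (Finset.mem_filter.1 hx).2
      refine ⟨x0, ?_⟩
      apply mul_left_cancel₀ (mul_ne_zero τ0 (pow_ne_zero (q + 1) x0))
      linear_combination hx1
    generalize (Finset.univ.filter fun x : F => x ≠ 0 ∧
        τ * x ^ (q + 1) * (b₀ + b₁ * x + b₂ * τ * x ^ (q + 1)) + 0 * x ^ 3 = 0) = S at *
    by_cases hb1 : b₁ = 0
    · subst hb1
      by_cases hb2 : b₂ = 0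
      · subst hb2
        have hb0 : b₀ ≠ 0 := by
          rintro rfl
          exact hne rfl
        have : S = ∅ := by
          apply Finset.eq_empty_of_forall_notMem
          intro x hx
          apply hb0
          simpa using (hred x hx).2
        simp [this]
      · apply Stmt18.pow_card (q + 1) (by omega) (- b₀ / (b₂ * τ))
        intro x hx
        field_simp
        linear_combination (hred x hx).2
    · have hinj : (S.image fun x => x ^ (q + 1)).card = S.card := by
        apply Finset.card_image_of_injOn
        intro x hx y hy hxy
        have h3 := (hred x hx).2
        have h4 := (hred y hy).2
        simp only at hxy
        apply mul_left_cancel₀ hb1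
        linear_combination h3 - h4 - b₂ * τ * hxy
      rw [← hinj]
      have := Stmt18.pow_card' q (by omega) 1 (S.image fun x => x ^ (q + 1)) (by
        intro n hn
        obtain ⟨x, hx, rfl⟩ := Finset.mem_image.1 hn
        refine ⟨pow_ne_zero _ (hred x hx).1, ?_⟩
        rw [← hσ, pow_succ, ← hσ, map_mul, hs]
        ring)
      omega
  · apply Stmt18.main_bound q hq4 σ hσ hs h2 hz (- τ * b₀ / ε) (- τ * b₁ / ε) (- τ ^ 2 * b₂ / ε)
    intro x hx
    obtain ⟨x0, hx1⟩ := (Finset.mem_filter.1 hx).2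
    refine ⟨x0, ?_⟩
    rw [pow_succ x q, ← hσ] at hx1
    field_simp
    apply mul_left_cancel₀ x0
    linear_combination hx1
end
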